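/- For every integer k ≥ 1 and constants M, R > 0 there exist constants C_k > 0 and c > 0 (c absolute) such that for every sufficiently small ε > 0 the following holds. Set n = ⌈C_k · ε^{−ck}⌉. There is a measurable estimator T : (Option ℝ)^n → ℝ^k × ℝ^k (depending only on k, M, R, ε) such that for every mixture with weights w_1, …, w_k > 0, Σ_i w_i = 1, means μ_1, …, μ_k ∈ (−M, M), satisfying w_min · Δ_min ≥ C_k · ε, where w_min = min_i w_i and Δ_min = min_{i≠j} |μ_i − μ_j|: if X_1, …, X_n are i.i.d. samples from the censored model (each X_s equals a real value x ∈ S = [−R,R] with density Σ_{i=1}^k w_i g_{μ_i}(x) on S, and equals FAIL with the remaining probability 1 − Σ_{i=1}^k w_i ∫_S g_{μ_i}(x) dx), then with probability at least 99/100 the output (ŵ_1, …, ŵ_k, μ̂_1, …, μ̂_k) = T(X_1, …, X_n) satisfies, for some permutation Π of {1, …, k}, |ŵ_{Π(i)} − w_i| < ε and |μ̂_{Π(i)} − μ_i| < ε for all i = 1, …, k. -/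

import Mathlib

open MeasureTheory Real Finset Matrix

/-- Borel-style measurable space on `Option ℝ`: `Option α` is identified with `α ⊕ PUnit`. -/
instance {α : Type} [MeasurableSpace α] : MeasurableSpace (Option α) :=
  MeasurableSpace.map (Equiv.optionEquivSumPUnit.{0} α).symm inferInstance

/-- Probabilists' Hermite polynomial evaluated at a real number. -/
noncomputable def hermiteR (j : ℕ) (x : ℝ) : ℝ := Polynomial.aeval x (Polynomial.hermite j)

/-- `J_{f,j} = ∫_S f(x) · (1/(√(2π)·j!)) · e^{-x²/2} · h_j(x) dx`, where `S = [-R, R]`. -/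
noncomputable def Jint (R : ℝ) (f : ℝ → ℝ) (j : ℕ) : ℝ :=
  ∫ x in Set.Icc (-R) R,
    f x * (1 / (Real.sqrt (2 * π) * (Nat.factorial j))) * Real.exp (-x ^ 2 / 2) * hermiteR j x

/-- The `ℓ×ℓ` matrix `V` with entries `V_{r,c} = J_{h_c, r}`. -/
noncomputable def Vmat (R : ℝ) (ℓ : ℕ) : Matrix (Fin ℓ) (Fin ℓ) ℝ :=
  Matrix.of fun r c : Fin ℓ => Jint R (hermiteR c) r

/-- The density of the normal distribution `N(μ, 1)`. -/
noncomputable def gaussd (μ x : ℝ) : ℝ := (1 / Real.sqrt (2 * π)) * Real.exp (-(x - μ) ^ 2 / 2)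

/-- The censored model on `Option ℝ`: its restriction to `ℝ` (embedded via `some`) has density
`∑_t w_t g_{μ_t}(x) · 1_{x ∈ [-R,R]}` with respect to Lebesgue measure, and the remaining mass
`1 - ∑_t w_t ∫_{[-R,R]} g_{μ_t}` is placed on `FAIL` (encoded as `none`). -/
noncomputable def censored (R : ℝ) (k : ℕ) (w μ : Fin k → ℝ) : Measure (Option ℝ) :=
  Measure.map Option.some
      (volume.withDensity fun x =>
        ENNReal.ofReal ((Set.Icc (-R) R).indicator (fun y => ∑ t, w t * gaussd (μ t) y) x))
    + (1 - ENNReal.ofReal (∫ x in Set.Icc (-R) R, ∑ t, w t * gaussd (μ t) x)) •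
        Measure.dirac (none : Option ℝ)

noncomputable def ES {ι : Type} [Fintype ι] (a z : ι → ℝ) (x : ℝ) : ℝ := ∑ t, a t * Real.exp (z t * x)

lemma ES_hasDeriv {ι : Type} [Fintype ι] (a z : ι → ℝ) (r x : ℝ) :
    HasDerivAt (fun x => Real.exp (-r * x) * ES a z x)
      (Real.exp (-r * x) * ES (fun t => a t * (z t - r)) z x) x := by
  have h1 : HasDerivAt (fun x => Real.exp (-r * x)) (Real.exp (-r * x) * (-r)) x := by
    have := ((hasDerivAt_id x).const_mul (-r)).exp
    simpa using this
  have h2 : HasDerivAt (fun x => ES a z x) (∑ t, a t * (Real.exp (z t * x) * z t)) x := by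
    unfold ES
    apply HasDerivAt.fun_sum
    intro t _
    have := (((hasDerivAt_id x).const_mul (z t)).exp).const_mul (a t)
    simpa using this
  refine (h1.mul h2).congr_deriv ?_
  unfold ES
  simp only [Finset.mul_sum]
  rw [← Finset.sum_add_distrib]
  apply Finset.sum_congr rfl
  intro t _
  ring

lemma rolle_key {ι : Type} [Fintype ι] (M R h : ℝ) (hM : 0 < M) (hR : 0 < R) (hh : 0 < h) (m : ℕ) :
    ∃ K : ℝ, 0 < K ∧ ∀ (l : List ℝ) (a z : ι → ℝ) (x : ℕ → ℝ) (δ : ℝ), 0 ≤ δ → l.length = m →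
      (∀ r ∈ l, |r| ≤ M) →
      (∀ t, a t * (l.map (fun r => z t - r)).prod = 0) →
      (∀ i < 2 ^ m, |x i| ≤ R) →
      (∀ i j, i < j → j < 2 ^ m → x i + h ≤ x j) →
      (∀ i < 2 ^ m, |ES a z (x i)| ≤ δ) →
      ∀ l1 l2, l = l1 ++ l2 → ∀ y, |y| ≤ R →
        |ES (fun t => a t * (l1.map (fun r => z t - r)).prod) z y| ≤ K * δ := by
  induction m with
  | zero =>
    refine ⟨1, one_pos, ?_⟩
    intro l a z x δ hδ hl hlM ha hx hsep hsm l1 l2 hl12 y hy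
    have : l = [] := List.length_eq_zero_iff.mp hl
    subst this
    obtain ⟨rfl, rfl⟩ := List.append_eq_nil_iff.mp hl12.symm
    have ha' : ∀ t, a t = 0 := fun t => by simpa using ha t
    simp [ES, ha', hδ]
  | succ m ih =>
    obtain ⟨K, hK, ih⟩ := ih
    set B := Real.exp (M * R) with hB
    have hB1 : 1 ≤ B := Real.one_le_exp (by positivity)
    have hB0 : 0 < B := by positivity
    set K1 := B * (2 * B / h) with hK1
    have hK10 : 0 < K1 := by positivity
    refine ⟨K * K1 + B * (B + B * (K * K1) * (2 * R)), by positivity, ?_⟩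
    intro l a z x δ hδ hl hlM ha hx hsep hsm l1 l2 hl12 y hy
    obtain ⟨r, l', rfl⟩ : ∃ r l', l = r :: l' := List.exists_cons_of_length_eq_add_one hl
    have hr : |r| ≤ M := hlM r (by simp)
    have hexp : ∀ y, |y| ≤ R → Real.exp (-r * y) ≤ B ∧ Real.exp (r * y) ≤ B := by
      intro y hy
      have : |r * y| ≤ M * R := by
        rw [abs_mul]; exact mul_le_mul hr hy (abs_nonneg _) hM.le
      have := abs_le.mp this
      constructor <;> apply Real.exp_le_exp.mpr <;> linarith
    set a' : ι → ℝ := fun t => a t * (z t - r) with ha'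
    set H : ℝ → ℝ := fun x => Real.exp (-r * x) * ES a z x with hH
    have hd : ∀ x, HasDerivAt H (Real.exp (-r * x) * ES a' z x) x := ES_hasDeriv a z r
    have hHx : ∀ i < 2 ^ (m+1), |H (x i)| ≤ B * δ := by
      intro i hi
      simp only [hH, abs_mul, Real.abs_exp]
      exact mul_le_mul (hexp _ (hx i hi)).1 (hsm i hi) (abs_nonneg _) hB0.le
    have hinv : ∀ y G, G = Real.exp (r * y) * (Real.exp (-r * y) * G) := by
      intro y G
      rw [← mul_assoc, ← Real.exp_add]; simp
    have hξ : ∀ i, ∃ ξ, i < 2 ^ m → x (2*i) < ξ ∧ ξ < x (2*i+1) ∧ |ES a' z ξ| ≤ K1 * δ := by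
      intro i
      by_cases hi : i < 2 ^ m
      swap
      · exact ⟨0, fun h => absurd h hi⟩
      have e : 2 ^ (m+1) = 2 * 2 ^ m := by ring
      have hlt := hsep (2*i) (2*i+1) (by omega) (by omega)
      obtain ⟨ξ, hξ, hs⟩ := exists_hasDerivAt_eq_slope H (fun x => Real.exp (-r * x) * ES a' z x)
        (show x (2*i) < x (2*i+1) by linarith)
        (fun x _ => (hd x).continuousAt.continuousWithinAt) (fun x _ => hd x)
      refine ⟨ξ, fun _ => ⟨hξ.1, hξ.2, ?_⟩⟩
      have hξR : |ξ| ≤ R := by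
        have h1 := abs_le.mp (hx (2*i) (by omega))
        have h2 := abs_le.mp (hx (2*i+1) (by omega))
        exact abs_le.mpr ⟨by linarith [hξ.1], by linarith [hξ.2]⟩
      have h1 : |Real.exp (-r * ξ) * ES a' z ξ| ≤ 2 * B / h * δ := by
        rw [hs, abs_div, abs_of_pos (show 0 < x (2*i+1) - x (2*i) by linarith)]
        rw [div_le_iff₀ (by linarith)]
        have h3 : |H (x (2*i+1)) - H (x (2*i))| ≤ 2 * B * δ := by
          have := abs_sub (H (x (2*i+1))) (H (x (2*i)))
          linarith [hHx (2*i) (by omega), hHx (2*i+1) (by omega)]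
        refine h3.trans ?_
        have : 2 * B * δ = 2 * B / h * δ * h := by field_simp
        rw [this]
        exact mul_le_mul_of_nonneg_left (by linarith) (by positivity)
      rw [hinv ξ (ES a' z ξ), abs_mul, Real.abs_exp, hK1, mul_assoc]
      exact mul_le_mul (hexp _ hξR).2 h1 (abs_nonneg _) hB0.le
    choose ξ hξ using hξ
    have e : 2 ^ (m+1) = 2 * 2 ^ m := by ring
    have IH := ih l' a' z ξ (K1 * δ) (by positivity) (by simpa using hl)
      (fun r hr => hlM r (by simp [hr])) (fun t => by
        have := ha t
        simp only [List.map_cons, List.prod_cons] at this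
        simp only [ha', mul_assoc]; exact this)
      (fun i hi => by
        have h1 := abs_le.mp (hx (2*i) (by omega))
        have h2 := abs_le.mp (hx (2*i+1) (by omega))
        exact abs_le.mpr ⟨by linarith [(hξ i hi).1], by linarith [(hξ i hi).2.1]⟩)
      (fun i j hij hj => by
        have h1 := (hξ i (by omega)).2.1
        have h2 := (hξ j hj).1
        have h3 := hsep (2*i+1) (2*j) (by omega) (by omega)
        linarith)
      (fun i hi => (hξ i hi).2.2)
    rcases l1 with _ | ⟨r1, l1'⟩
    · have hall : ∀ y, |y| ≤ R → |ES a' z y| ≤ K * (K1 * δ) := by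
        intro y hy
        have := IH [] l' rfl y hy
        simpa using this
      have hx0 := hx 0 (by positivity)
      have hmv : |H y - H (x 0)| ≤ (B * (K * (K1 * δ))) * |y - x 0| := by
        have := Convex.norm_image_sub_le_of_norm_hasDerivWithin_le (f := H)
          (f' := fun x => Real.exp (-r * x) * ES a' z x) (s := Set.Icc (-R) R)
          (C := B * (K * (K1 * δ))) (x := x 0) (y := y)
          (fun x _ => (hd x).hasDerivWithinAt)
          (fun x hx => by
            have hx' : |x| ≤ R := abs_le.mpr hx
            rw [Real.norm_eq_abs, abs_mul, Real.abs_exp]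
            exact mul_le_mul (hexp _ hx').1 (hall x hx') (abs_nonneg _) hB0.le)
          (convex_Icc _ _) (abs_le.mp hx0) (abs_le.mp hy)
        simpa using this
      have hyx : |y - x 0| ≤ 2 * R := by
        have := abs_sub y (x 0); linarith
      have hHy : |H y| ≤ B * δ + (B * (K * (K1 * δ))) * (2 * R) := by
        have h1 := abs_sub_abs_le_abs_sub (H y) (H (x 0))
        have h2 := hHx 0 (by positivity)
        have h3 : (B * (K * (K1 * δ))) * |y - x 0| ≤ (B * (K * (K1 * δ))) * (2 * R) :=
          mul_le_mul_of_nonneg_left hyx (by positivity)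
        linarith
      have : |ES a z y| ≤ B * (B * δ + (B * (K * (K1 * δ))) * (2 * R)) := by
        rw [hinv y (ES a z y), abs_mul, Real.abs_exp]
        exact mul_le_mul (hexp _ hy).2 hHy (abs_nonneg _) hB0.le
      simp only [List.map_nil, List.prod_nil, mul_one]
      refine this.trans ?_
      have : 0 ≤ K * K1 * δ := by positivity
      nlinarith
    · simp only [List.cons_append, List.cons.injEq] at hl12
      obtain ⟨rfl, rfl⟩ := hl12
      have := IH l1' l2 rfl y hy
      simp only [List.map_cons, List.prod_cons]
      simp only [ha', mul_assoc] at this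
      refine this.trans ?_
      have : 0 ≤ (B * (B + B * (K * K1) * (2 * R))) * δ := by positivity
      nlinarith

noncomputable def lft (R : ℝ) (N j : ℕ) : ℝ := -R + 2 * j * (R / N)

noncomputable def rgt (R : ℝ) (N j : ℕ) : ℝ := -R + (2 * j + 1) * (R / N)

noncomputable def PP (R : ℝ) (N k : ℕ) (w μ : Fin k → ℝ) (j : ℕ) : ℝ :=
  ∫ x in Set.Icc (lft R N j) (rgt R N j), ∑ t, w t * gaussd (μ t) x

lemma lft_lt {R : ℝ} (hR : 0 < R) {N j : ℕ} (hj : j < N) : lft R N j < rgt R N j := by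
  have hN : (0:ℝ) < N := by exact_mod_cast (by omega : 0 < N)
  have : 0 < R / N := by positivity
  unfold lft rgt; nlinarith

lemma lft_ge {R : ℝ} (hR : 0 < R) {N j : ℕ} (hj : j < N) : -R ≤ lft R N j := by
  have hN : (0:ℝ) < N := by exact_mod_cast (by omega : 0 < N)
  have : 0 < R / N := by positivity
  unfold lft
  have : 0 ≤ 2 * (j:ℝ) * (R / N) := by positivity
  linarith

lemma rgt_le {R : ℝ} (hR : 0 < R) {N j : ℕ} (hj : j < N) : rgt R N j ≤ R := by
  have hN : (0:ℝ) < N := by exact_mod_cast (by omega : 0 < N)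
  have h1 : 0 < R / N := by positivity
  have h2 : (N:ℝ) * (R / N) = R := by field_simp
  have h3 : (j:ℝ) + 1 ≤ N := by exact_mod_cast hj
  unfold rgt
  nlinarith

lemma lft_rgt_sep {R : ℝ} (hR : 0 < R) {N i j : ℕ} (hij : i < j) (hj : j < N) :
    rgt R N i + R / N ≤ lft R N j := by
  have hN : (0:ℝ) < N := by exact_mod_cast (by omega : 0 < N)
  have h1 : 0 < R / N := by positivity
  have h3 : (i:ℝ) + 1 ≤ j := by exact_mod_cast hij
  unfold rgt lft
  nlinarith

lemma gaussd_cont (μ : ℝ) : Continuous (gaussd μ) := by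
  unfold gaussd; fun_prop

lemma mix_cont {k : ℕ} (w μ : Fin k → ℝ) : Continuous (fun x => ∑ t, w t * gaussd (μ t) x) := by
  refine continuous_finsetSum _ fun t _ => continuous_const.mul (gaussd_cont _)

lemma gaussd_eq (μ x : ℝ) : gaussd μ x =
    (1 / Real.sqrt (2 * π)) * Real.exp (-x ^ 2 / 2) * (Real.exp (-μ ^ 2 / 2) * Real.exp (μ * x)) := by
  unfold gaussd
  rw [mul_assoc, ← Real.exp_add, ← Real.exp_add]
  congr 2; ring

noncomputable def AA {k : ℕ} (w μ : Fin k → ℝ) (t : Fin k) : ℝ := w t * Real.exp (-(μ t) ^ 2 / 2)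

lemma mix_eq_ES {k : ℕ} (w μ w' μ' : Fin k → ℝ) (x : ℝ) :
    ∑ t, w t * gaussd (μ t) x - ∑ t, w' t * gaussd (μ' t) x =
      (1 / Real.sqrt (2 * π)) * Real.exp (-x ^ 2 / 2) *
        ES (Sum.elim (AA w μ) (fun t => -AA w' μ' t)) (Sum.elim μ μ') x := by
  unfold ES AA
  rw [Fintype.sum_sum_type]
  simp only [Sum.elim_inl, Sum.elim_inr, gaussd_eq, mul_add, Finset.mul_sum]
  rw [sub_eq_add_neg, ← Finset.sum_neg_distrib]
  congr 1 <;> (apply Finset.sum_congr rfl; intro t _; ring)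

lemma point_of_interval {k : ℕ} (w μ w' μ' : Fin k → ℝ) {R δ : ℝ} (hR : 0 < R) {N j : ℕ} (hj : j < N)
    (h : |PP R N k w μ j - PP R N k w' μ' j| ≤ δ) :
    ∃ x ∈ Set.Icc (lft R N j) (rgt R N j),
      |ES (Sum.elim (AA w μ) (fun t => -AA w' μ' t)) (Sum.elim μ μ') x| ≤
        (Real.sqrt (2 * π) * Real.exp (R ^ 2 / 2) * (N / R)) * δ := by
  have hlt := lft_lt hR hj
  have hN : (0:ℝ) < N := by exact_mod_cast (by omega : 0 < N)
  set f : ℝ → ℝ := fun x => ∑ t, w t * gaussd (μ t) x - ∑ t, w' t * gaussd (μ' t) x with hf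
  have hfc : Continuous f := (mix_cont w μ).sub (mix_cont w' μ')
  have hint : PP R N k w μ j - PP R N k w' μ' j = ∫ x in (lft R N j)..(rgt R N j), f x := by
    rw [intervalIntegral.integral_of_le hlt.le, ← integral_Icc_eq_integral_Ioc, hf, integral_sub]
    · rfl
    · exact (mix_cont w μ).integrableOn_Icc
    · exact (mix_cont w' μ').integrableOn_Icc
  obtain ⟨c, hc, hs⟩ := exists_hasDerivAt_eq_slope (fun y => ∫ x in (lft R N j)..y, f x) f hlt
    (fun y _ => (intervalIntegral.integral_hasDerivAt_right (hfc.intervalIntegrable _ _)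
      (hfc.stronglyMeasurableAtFilter _ _) hfc.continuousAt).continuousAt.continuousWithinAt)
    (fun y _ => intervalIntegral.integral_hasDerivAt_right (hfc.intervalIntegrable _ _)
      (hfc.stronglyMeasurableAtFilter _ _) hfc.continuousAt)
  refine ⟨c, ⟨hc.1.le, hc.2.le⟩, ?_⟩
  have hlen : rgt R N j - lft R N j = R / N := by unfold rgt lft; ring
  simp only [intervalIntegral.integral_same, sub_zero, ← hint, hlen] at hs
  rw [hf] at hs
  simp only [mix_eq_ES] at hs
  set G := ES (Sum.elim (AA w μ) (fun t => -AA w' μ' t)) (Sum.elim μ μ') c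
  have hcR : c ^ 2 ≤ R ^ 2 := by
    have := lft_ge hR hj; have := rgt_le hR hj
    apply sq_le_sq'  <;> linarith [hc.1, hc.2]
  have hs2 : 0 < Real.sqrt (2 * π) := by positivity
  have : G = Real.sqrt (2 * π) * Real.exp (c ^ 2 / 2) * (N / R) * (PP R N k w μ j - PP R N k w' μ' j) := by
    have h2 : Real.exp (c^2/2) * Real.exp (-c^2/2) = 1 := by rw [← Real.exp_add]; simp [neg_div]
    have h3 : (PP R N k w μ j - PP R N k w' μ' j) = R / N * (1 / √(2 * π) * rexp (-c ^ 2 / 2) * G) := by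
      rw [hs]; field_simp
    rw [h3]
    calc G = (Real.exp (c^2/2) * Real.exp (-c^2/2)) * G := by rw [h2, one_mul]
      _ = _ := by field_simp
  rw [this, abs_mul, abs_of_pos (by positivity)]
  gcongr

lemma ident_moments (k : ℕ) (hk : 1 ≤ k) (M R : ℝ) (hM : 0 < M) (hR : 0 < R) :
    ∃ K : ℝ, 0 < K ∧ ∀ (w μ w' μ' : Fin k → ℝ) (δ : ℝ), 0 ≤ δ → (∀ t, |μ t| ≤ M) → (∀ t, |μ' t| ≤ M) →
      (∀ j < 2 ^ (2 * k), |PP R (2 ^ (2 * k)) k w μ j - PP R (2 ^ (2 * k)) k w' μ' j| ≤ δ) → ∀ t,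
      |AA w μ t * ((∏ i ∈ univ.erase t, (μ t - μ i)) * ∏ s, (μ t - μ' s))| ≤ K * δ ∧
      |AA w μ t * (∏ i ∈ univ.erase t, (μ t - μ i)) -
        ∑ s, AA w' μ' s * ∏ i ∈ univ.erase t, (μ' s - μ i)| ≤ K * δ := by
  have hNpos : (0:ℝ) < ((2 ^ (2 * k) : ℕ) : ℝ) := by positivity
  obtain ⟨K, hK, H⟩ := rolle_key (ι := Fin k ⊕ Fin k) M R (R / ((2 ^ (2 * k) : ℕ) : ℝ)) hM hR
    (by positivity) (2 * k)
  set K0 := (Real.sqrt (2 * π) * Real.exp (R ^ 2 / 2) * (((2 ^ (2 * k) : ℕ) : ℝ) / R))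
  have hK0 : 0 < K0 := by positivity
  refine ⟨K * K0, by positivity, ?_⟩
  intro w μ w' μ' δ hδ hμ hμ' hP t
  have : ∀ j, ∃ x, j < 2 ^ (2 * k) → x ∈ Set.Icc (lft R (2 ^ (2 * k)) j) (rgt R (2 ^ (2 * k)) j) ∧
      |ES (Sum.elim (AA w μ) (fun t => -AA w' μ' t)) (Sum.elim μ μ') x| ≤ K0 * δ := by
    intro j
    by_cases hj : j < 2 ^ (2 * k)
    · obtain ⟨x, h1, h2⟩ := point_of_interval w μ w' μ' hR hj (hP j hj)
      exact ⟨x, fun _ => ⟨h1, h2⟩⟩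
    · exact ⟨0, fun h => absurd h hj⟩
  choose x hx using this
  set a := Sum.elim (AA w μ) (fun t => -AA w' μ' t)
  set z := Sum.elim μ μ' with hz
  have key : ∀ l : List ℝ, l.length = 2 * k → (∀ r ∈ l, |r| ≤ M) →
      (∀ t, a t * (l.map (fun r => z t - r)).prod = 0) → ∀ l1 l2, l = l1 ++ l2 →
        |∑ t, a t * (l1.map (fun r => z t - r)).prod| ≤ K * K0 * δ := by
    intro l h1 h2 h3 l1 l2 hl
    have := H l a z x (K0 * δ) (by positivity) h1 h2 h3
      (fun i hi => by
        have := (hx i hi).1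
        have := lft_ge hR hi; have := rgt_le hR hi
        exact abs_le.mpr ⟨by linarith [(hx i hi).1.1], by linarith [(hx i hi).1.2]⟩)
      (fun i j hij hj => by
        have h1 := (hx i (by omega)).1.2
        have h2 := (hx j hj).1.1
        have := lft_rgt_sep hR hij hj
        linarith)
      (fun i hi => (hx i hi).2) l1 l2 hl 0 (by simpa using hR.le)
    simpa [ES, mul_assoc] using this
  set A : List ℝ := (univ.erase t).toList.map μ with hA
  set B : List ℝ := (univ : Finset (Fin k)).toList.map μ' with hB
  have hprodA : ∀ y, (A.map (fun r => y - r)).prod = ∏ i ∈ univ.erase t, (y - μ i) := by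
    intro y
    rw [hA, List.map_map, ← Finset.prod_map_toList]; rfl
  have hprodB : ∀ y, (B.map (fun r => y - r)).prod = ∏ i, (y - μ' i) := by
    intro y
    rw [hB, List.map_map, ← Finset.prod_map_toList]; rfl
  have hmA : ∀ r ∈ A, |r| ≤ M := by
    intro r hr
    obtain ⟨i, -, rfl⟩ := List.mem_map.mp hr
    exact hμ i
  have hmB : ∀ r ∈ B, |r| ≤ M := by
    intro r hr
    obtain ⟨i, -, rfl⟩ := List.mem_map.mp hr
    exact hμ' i
  have hlA : A.length = k - 1 := by simp [hA]
  have hlB : B.length = k := by simp [hB]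
  have hA0 : ∀ s, s ≠ t → ∏ i ∈ univ.erase t, (μ s - μ i) = 0 := by
    intro s hs
    exact Finset.prod_eq_zero (i := s) (by simp [hs]) (by simp)
  have hB0 : ∀ s, ∏ i, (μ' s - μ' i) = 0 := by
    intro s
    exact Finset.prod_eq_zero (i := s) (by simp) (by simp)
  have hzero : ∀ u, (A.map (fun r => z u - r)).prod * (B.map (fun r => z u - r)).prod * (z u - μ t) = 0 := by
    intro u
    rcases u with s | s
    · simp only [hz, Sum.elim_inl, hprodA, hprodB]
      by_cases hs : s = t
      · simp [hs]
      · rw [hA0 s hs]; simp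
    · simp only [hz, Sum.elim_inr, hprodA, hprodB, hB0]; simp
  constructor
  · have h := key (A ++ B ++ [μ t]) (by simp [hlA, hlB]; omega)
      (by
        intro r hr
        simp only [List.mem_append, List.mem_singleton] at hr
        rcases hr with (hr | hr) | rfl
        exacts [hmA r hr, hmB r hr, hμ t])
      (fun u => by
        simp only [List.map_append, List.prod_append, List.map_cons, List.map_nil, List.prod_cons,
          List.prod_nil, mul_one, hzero, mul_zero]) (A ++ B) [μ t] rfl
    simp only [List.map_append, List.prod_append, hprodA, hprodB, Fintype.sum_sum_type, hz, Sum.elim_inl,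
      Sum.elim_inr, hB0, mul_zero, Finset.sum_const_zero, add_zero] at h
    rw [Finset.sum_eq_single t (fun s _ hs => by rw [hA0 s hs]; simp) (by simp)] at h
    exact h
  · have h := key (A ++ (B ++ [μ t])) (by simp [hlA, hlB]; omega)
      (by
        intro r hr
        simp only [List.mem_append, List.mem_singleton] at hr
        rcases hr with hr | (hr | rfl)
        exacts [hmA r hr, hmB r hr, hμ t])
      (fun u => by
        have := hzero u
        simp only [List.map_append, List.prod_append, List.map_cons, List.map_nil, List.prod_cons,
          List.prod_nil, mul_one, ← mul_assoc] at this ⊢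
        rw [mul_assoc, mul_assoc, ← mul_assoc _ _ (z u - μ t), this, mul_zero]) A (B ++ [μ t]) rfl
    simp only [hprodA, Fintype.sum_sum_type, hz, Sum.elim_inl, Sum.elim_inr] at h
    rw [Finset.sum_eq_single t (fun s _ hs => by rw [hA0 s hs]; simp) (by simp)] at h
    simp only [a, Sum.elim_inl, Sum.elim_inr, neg_mul, Finset.sum_neg_distrib, ← sub_eq_add_neg] at h
    exact h

lemma prod_sub_lip {ι : Type} (s : Finset ι) (c : ι → ℝ) (x y B : ℝ) (hB : 1 ≤ B)
    (hx : ∀ i ∈ s, |x - c i| ≤ B) (hy : ∀ i ∈ s, |y - c i| ≤ B) :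
    |∏ i ∈ s, (x - c i) - ∏ i ∈ s, (y - c i)| ≤ s.card * B ^ s.card * |x - y| := by
  classical
  induction s using Finset.induction_on with
  | empty => simp
  | insert a s ha ih =>
    rw [Finset.prod_insert ha, Finset.prod_insert ha, Finset.card_insert_of_notMem ha]
    have ih' := ih (fun i hi => hx i (by simp [hi])) (fun i hi => hy i (by simp [hi]))
    have h1 : |∏ i ∈ s, (y - c i)| ≤ B ^ s.card := by
      rw [Finset.abs_prod]
      have := Finset.prod_le_prod (s := s) (f := fun i => |y - c i|) (g := fun _ => B)
        (fun _ _ => abs_nonneg _) (fun i hi => hy i (by simp [hi]))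
      simpa using this
    set P := ∏ i ∈ s, (x - c i)
    set Q := ∏ i ∈ s, (y - c i)
    have h2 : (x - c a) * P - (y - c a) * Q = (x - c a) * (P - Q) + (x - y) * Q := by ring
    rw [h2]
    have h3 : |(x - c a) * (P - Q)| ≤ B * (s.card * B ^ s.card * |x - y|) := by
      rw [abs_mul]
      exact mul_le_mul (hx a (by simp)) ih' (abs_nonneg _) (by linarith)
    have h4 : |(x - y) * Q| ≤ |x - y| * B ^ s.card := by
      rw [abs_mul]; exact mul_le_mul_of_nonneg_left h1 (abs_nonneg _)
    have h5 : |x - y| * B ^ s.card ≤ |x - y| * B ^ (s.card + 1) :=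
      mul_le_mul_of_nonneg_left (pow_le_pow_right₀ hB (by omega)) (abs_nonneg _)
    refine (abs_add_le _ _).trans ?_
    push_cast
    have h6 : B ^ (s.card + 1) = B * B ^ s.card := by ring
    rw [h6] at h5 ⊢
    nlinarith

lemma exp_sq_lip {M x y : ℝ} (hx : |x| ≤ M) (hy : |y| ≤ M) :
    |Real.exp (x ^ 2 / 2) - Real.exp (y ^ 2 / 2)| ≤ Real.exp (M ^ 2 / 2) * M * |x - y| := by
  have hM : 0 ≤ M := (abs_nonneg x).trans hx
  have key : ∀ x y : ℝ, |x| ≤ M → |y| ≤ M →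
      Real.exp (x ^ 2 / 2) - Real.exp (y ^ 2 / 2) ≤ Real.exp (M ^ 2 / 2) * M * |x - y| := by
    intro x y hx hy
    have h1 := Real.add_one_le_exp (y ^ 2 / 2 - x ^ 2 / 2)
    have h2 : Real.exp (y ^ 2 / 2) = Real.exp (x ^ 2 / 2) * Real.exp (y ^ 2 / 2 - x ^ 2 / 2) := by
      rw [← Real.exp_add]; congr 1; ring
    have h3 : Real.exp (x ^ 2 / 2) ≤ Real.exp (M ^ 2 / 2) := by
      apply Real.exp_le_exp.mpr
      have := sq_le_sq' (abs_le.mp hx).1 (abs_le.mp hx).2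
      linarith
    have h4 : x ^ 2 / 2 - y ^ 2 / 2 ≤ M * |x - y| := by
      have : x ^ 2 / 2 - y ^ 2 / 2 = ((x + y) / 2) * (x - y) := by ring
      rw [this]
      refine (le_abs_self _).trans ?_
      rw [abs_mul]
      refine mul_le_mul_of_nonneg_right ?_ (abs_nonneg _)
      rw [abs_div, abs_two]
      linarith [abs_add_le x y]
    have h5 : Real.exp (x ^ 2 / 2) - Real.exp (y ^ 2 / 2) ≤
        Real.exp (x ^ 2 / 2) * (x ^ 2 / 2 - y ^ 2 / 2) := by
      rw [h2]
      have := mul_le_mul_of_nonneg_left h1 (Real.exp_pos (x ^ 2 / 2)).le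
      linarith
    refine h5.trans ?_
    rw [mul_assoc]
    calc _ ≤ Real.exp (x ^ 2 / 2) * (M * |x - y|) := mul_le_mul_of_nonneg_left h4 (Real.exp_pos _).le
      _ ≤ _ := mul_le_mul_of_nonneg_right h3 (by positivity)
  rw [abs_le]
  constructor
  · have := key y x hy hx
    rw [abs_sub_comm] at this; linarith
  · exact key x y hx hy

structure Good (k : ℕ) (M ε : ℝ) (w μ : Fin k → ℝ) : Prop where
  pos : ∀ t, 0 < w t
  sum : ∑ t, w t = 1
  bd : ∀ t, |μ t| ≤ M
  wlow : ∀ t, ε ≤ w t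
  sep : ∀ s t, s ≠ t → 4 * ε ≤ |μ s - μ t|

lemma Good.w_le {k : ℕ} {M ε : ℝ} {w μ : Fin k → ℝ} (h : Good k M ε w μ) (t : Fin k) : w t ≤ 1 := by
  rw [← h.sum]; exact Finset.single_le_sum (fun i _ => (h.pos i).le) (Finset.mem_univ t)

lemma AA_le {k : ℕ} {M ε : ℝ} {w μ : Fin k → ℝ} (h : Good k M ε w μ) (t : Fin k) :
    AA w μ t ≤ w t := by
  unfold AA
  have : Real.exp (-(μ t) ^ 2 / 2) ≤ 1 := Real.exp_le_one_iff.mpr (by nlinarith [sq_nonneg (μ t)])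
  exact mul_le_of_le_one_right (h.pos t).le this

lemma AA_pos {k : ℕ} {M ε : ℝ} {w μ : Fin k → ℝ} (h : Good k M ε w μ) (t : Fin k) :
    0 < AA w μ t := mul_pos (h.pos t) (Real.exp_pos _)

lemma w_eq_AA {k : ℕ} (w μ : Fin k → ℝ) (t : Fin k) :
    w t = AA w μ t * Real.exp ((μ t) ^ 2 / 2) := by
  unfold AA
  rw [mul_assoc, ← Real.exp_add]; simp [neg_div]

lemma exp_sq_le {M x : ℝ} (hx : |x| ≤ M) : Real.exp (x ^ 2 / 2) ≤ Real.exp (M ^ 2 / 2) := by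
  apply Real.exp_le_exp.mpr
  have := sq_le_sq' (abs_le.mp hx).1 (abs_le.mp hx).2
  linarith

set_option maxHeartbeats 1000000 in
lemma ident (k : ℕ) (hk : 1 ≤ k) (M R : ℝ) (hM : 0 < M) (hR : 0 < R) :
    ∃ c0 : ℝ, 0 < c0 ∧ ∀ (ε : ℝ) (w μ w' μ' : Fin k → ℝ), 0 < ε → ε < 1 →
      Good k M ε w μ → Good k M ε w' μ' →
      (∀ j < 2 ^ (2 * k), |PP R (2 ^ (2 * k)) k w μ j - PP R (2 ^ (2 * k)) k w' μ' j| ≤ c0 * ε ^ (4 * k)) →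
      ∃ perm : Equiv.Perm (Fin k), ∀ t, |w' (perm t) - w t| < ε ∧ |μ' (perm t) - μ t| < ε := by
  obtain ⟨K, hK, H⟩ := ident_moments k hk M R hM hR
  set E := Real.exp (M ^ 2 / 2) with hE
  have hE0 : 0 < E := Real.exp_pos _
  set K1 := K * E with hK1
  set B := 2 * M + 1 with hB
  set L := (k:ℝ) * B ^ k with hL
  set K2 := K + L * K1 with hK2
  set S := 2 * (1 + K1 + E * K2 + E * M * K1) with hS
  have hK10 : 0 < K1 := by positivity
  have hL0 : 0 ≤ L := by positivity
  have hK20 : 0 < K2 := by positivity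
  have hS0 : 0 < S := by positivity
  refine ⟨1 / S, by positivity, ?_⟩
  intro ε w μ w' μ' hε hε1 hG hG' hP
  set c0 := 1 / S with hc0
  have hc00 : 0 < c0 := by positivity
  have hcS : c0 * S = 1 := by rw [hc0]; field_simp
  have hterm1 : 0 < c0 * K1 := by positivity
  have hterm2 : 0 < c0 * (E * K2) := by positivity
  have hterm3 : 0 < c0 * (E * M * K1) := by positivity
  have hcS' : c0 * 2 + 2 * (c0 * K1) + 2 * (c0 * (E * K2)) + 2 * (c0 * (E * M * K1)) = 1 := by
    rw [← hcS, hS]; ring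
  set δ := c0 * ε ^ (4 * k) with hδ
  have hδ0 : 0 < δ := by positivity
  have H1 := H w μ w' μ' δ hδ0.le hG.bd hG'.bd hP
  set e := ε ^ k with he
  have he0 : 0 < e := by positivity
  have heε : e ≤ ε := by
    rw [he]; exact pow_le_of_le_one hε.le hε1.le (by omega)
  have he1 : e < 1 := by linarith
  have hek : e ≤ ε ^ (k - 1) := pow_le_pow_of_le_one hε.le hε1.le (by omega)
  have hδe : δ = c0 * e ^ 4 := by rw [hδ, he, ← pow_mul]; ring_nf
  have hq : ∀ t, e ≤ |∏ i ∈ univ.erase t, (μ t - μ i)| := by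
    intro t
    refine hek.trans ?_
    rw [Finset.abs_prod]
    have := Finset.prod_le_prod (s := univ.erase t) (f := fun _ => ε) (g := fun i => |μ t - μ i|)
      (fun _ _ => hε.le) (fun i hi => by
        have := hG.sep t i (Finset.ne_of_mem_erase hi).symm
        linarith)
    simpa using this
  have hprod : ∀ t, (∏ s, |μ t - μ' s|) * (ε * e) ≤ K1 * δ := by
    intro t
    have h1 := (H1 t).1
    rw [abs_mul, abs_mul, Finset.abs_prod univ, abs_of_pos (AA_pos hG t)] at h1
    set Q := ∏ s, |μ t - μ' s|
    have hQ : 0 ≤ Q := Finset.prod_nonneg fun _ _ => abs_nonneg _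
    have h2 : ε ≤ AA w μ t * E := by
      refine (hG.wlow t).trans ?_
      rw [w_eq_AA w μ t]
      exact mul_le_mul_of_nonneg_left (exp_sq_le (hG.bd t)) (AA_pos hG t).le
    calc Q * (ε * e) ≤ Q * ((AA w μ t * E) * |∏ i ∈ univ.erase t, (μ t - μ i)|) := by
          apply mul_le_mul_of_nonneg_left _ hQ
          exact mul_le_mul h2 (hq t) he0.le (by linarith)
      _ = E * (AA w μ t * (|∏ i ∈ univ.erase t, (μ t - μ i)| * Q)) := by ring
      _ ≤ E * (K * δ) := mul_le_mul_of_nonneg_left h1 hE0.le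
      _ = K1 * δ := by rw [hK1]; ring
  have hKδ : K1 * δ < e ^ 4 := by
    rw [hδe]
    have : c0 * K1 < 1 := by linarith
    have h4 : 0 < e ^ 4 := by positivity
    calc K1 * (c0 * e ^ 4) = (c0 * K1) * e ^ 4 := by ring
      _ < e ^ 4 := mul_lt_of_lt_one_left h4 this
  have hex : ∀ t, ∃ s, |μ t - μ' s| < ε := by
    intro t
    by_contra! hcon
    have h1 := Finset.prod_le_prod (s := univ) (f := fun _ => ε) (g := fun s => |μ t - μ' s|)
      (fun _ _ => hε.le) (fun i hi => hcon i)
    simp only [Finset.prod_const, Finset.card_univ, Fintype.card_fin, ← he] at h1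
    have h2 := hprod t
    have h3 : e * (ε * e) ≤ e ^ 4 := by
      have := mul_le_mul_of_nonneg_right h1 (show 0 ≤ ε * e by positivity)
      linarith
    have h4 : e * (e * e) ≤ e * (ε * e) := by gcongr
    have h5 : e ^ 4 < e * (e * e) := by
      have h3 : 0 < e ^ 3 := by positivity
      calc e ^ 4 = e * e ^ 3 := by ring
        _ < e ^ 3 := mul_lt_of_lt_one_left h3 he1
        _ = _ := by ring
    linarith
  choose p hp using hex
  have hinj : Function.Injective p := by
    intro s t hst
    by_contra hne
    have h1 := hG.sep s t hne
    have h2 := hp s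
    have h3 := hp t
    rw [hst] at h2
    have : |μ s - μ t| ≤ |μ s - μ' (p t)| + |μ t - μ' (p t)| := by
      rw [abs_sub_comm (μ t)]; exact abs_sub_le _ _ _
    linarith
  set π' : Equiv.Perm (Fin k) := Equiv.ofBijective p (Finite.injective_iff_bijective.mp hinj) with hπ
  have hπp : ∀ t, π' t = p t := fun t => rfl
  have hρ : ∀ t, |μ t - μ' (p t)| ≤ K1 * c0 * e ^ 2 := by
    intro t
    have h1 := Finset.prod_le_prod (s := univ.erase (p t)) (f := fun _ => ε) (g := fun s => |μ t - μ' s|)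
      (fun _ _ => hε.le) (fun i hi => by
        have h1 := hG'.sep (p t) i (Finset.ne_of_mem_erase hi).symm
        have h2 := hp t
        have : |μ' (p t) - μ' i| ≤ |μ t - μ' (p t)| + |μ t - μ' i| := by
          rw [abs_sub_comm (μ t) (μ' (p t))]; exact abs_sub_le _ _ _
        linarith)
    simp only [Finset.prod_const, Finset.card_univ, Fintype.card_fin, Finset.mem_univ,
      Finset.card_erase_of_mem] at h1
    have h2 := hprod t
    have h4 := Finset.mul_prod_erase univ (fun s => |μ t - μ' s|) (Finset.mem_univ (p t))
    have hεe : ε ^ (k - 1) * ε = e := by rw [he, ← pow_succ]; congr 1; omega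
    have h3 : |μ t - μ' (p t)| * (e * e) ≤ K1 * δ := by
      calc |μ t - μ' (p t)| * (e * e) = |μ t - μ' (p t)| * ε ^ (k-1) * (ε * e) := by
            rw [← hεe]; ring
        _ ≤ (∏ s, |μ t - μ' s|) * (ε * e) := by
            rw [← h4]; gcongr
        _ ≤ K1 * δ := by linarith
    have h6 : 0 < e * e := by positivity
    rw [hδe] at h3
    have h7 : K1 * (c0 * e ^ 4) = (K1 * c0 * e ^ 2) * (e * e) := by ring
    rw [h7] at h3
    exact le_of_mul_le_mul_right h3 h6
  set ρ := K1 * c0 * e ^ 2 with hρdef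
  have hρ0 : 0 < ρ := by positivity
  have hB1 : 1 ≤ B := by rw [hB]; linarith
  have hAA : ∀ t, |AA w μ t - AA w' μ' (p t)| ≤ K2 * c0 * e := by
    intro t
    set q : ℝ → ℝ := fun y => ∏ i ∈ univ.erase t, (y - μ i) with hqd
    have h1 : |AA w μ t * q (μ t) - ∑ s, AA w' μ' s * q (μ' s)| ≤ K * δ := (H1 t).2
    have hqlip : ∀ i, |q (μ i) - q (μ' (p i))| ≤ L * ρ := by
      intro i
      have hb : ∀ x, |x| ≤ M → ∀ i, |x - μ i| ≤ B := by
        intro x hx i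
        have := abs_sub x (μ i)
        have := hG.bd i
        rw [hB]; linarith
      have := prod_sub_lip (univ.erase t) μ (μ i) (μ' (p i)) B hB1
        (fun j _ => hb _ (hG.bd i) j) (fun j _ => hb _ (hG'.bd _) j)
      refine this.trans ?_
      have hc : (univ.erase t).card ≤ k := by simp
      have hc' : ((univ.erase t).card : ℝ) ≤ k := by exact_mod_cast hc
      rw [hL]
      have hpw : B ^ (univ.erase t).card ≤ B ^ k := pow_le_pow_right₀ hB1 hc
      have hBp : 0 < B := by linarith
      exact mul_le_mul (mul_le_mul hc' hpw (by positivity) (by positivity)) (hρ i) (abs_nonneg _) (by positivity)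
    have h2 : ∑ s, AA w' μ' s * q (μ' s) = ∑ i, AA w' μ' (p i) * q (μ' (p i)) :=
      (Equiv.sum_comp π' (fun s => AA w' μ' s * q (μ' s))).symm
    have h3 : AA w' μ' (p t) * q (μ t) = ∑ i, AA w' μ' (p i) * q (μ i) := by
      rw [Finset.sum_eq_single t]
      · intro s _ hs
        have : q (μ s) = 0 := Finset.prod_eq_zero (i := s) (by simp [hs]) (by simp)
        rw [this, mul_zero]
      · simp
    have hs1 : ∑ i, AA w' μ' (p i) ≤ 1 := by
      have : ∑ i, AA w' μ' (p i) = ∑ s, AA w' μ' s := Equiv.sum_comp π' (fun s => AA w' μ' s)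
      rw [this, ← hG'.sum]
      exact Finset.sum_le_sum fun i _ => AA_le hG' i
    have h4 : |AA w' μ' (p t) * q (μ t) - ∑ s, AA w' μ' s * q (μ' s)| ≤ L * ρ := by
      rw [h2, h3, ← Finset.sum_sub_distrib]
      refine (Finset.abs_sum_le_sum_abs _ _).trans ?_
      calc _ ≤ ∑ i, AA w' μ' (p i) * (L * ρ) := by
            apply Finset.sum_le_sum
            intro i _
            rw [← mul_sub, abs_mul, abs_of_pos (AA_pos hG' _)]
            exact mul_le_mul_of_nonneg_left (hqlip i) (AA_pos hG' _).le
        _ = (∑ i, AA w' μ' (p i)) * (L * ρ) := by rw [Finset.sum_mul]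
        _ ≤ 1 * (L * ρ) := mul_le_mul_of_nonneg_right hs1 (by positivity)
        _ = _ := one_mul _
    have h5 : |AA w μ t - AA w' μ' (p t)| * |q (μ t)| ≤ K * δ + L * ρ := by
      rw [← abs_mul, sub_mul]
      have := abs_sub_le (AA w μ t * q (μ t)) (∑ s, AA w' μ' s * q (μ' s)) (AA w' μ' (p t) * q (μ t))
      rw [abs_sub_comm (∑ s, AA w' μ' s * q (μ' s)) (AA w' μ' (p t) * q (μ t))] at this
      linarith
    have h6 : |AA w μ t - AA w' μ' (p t)| * e ≤ K * δ + L * ρ :=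
      (mul_le_mul_of_nonneg_left (hq t) (abs_nonneg _)).trans h5
    have h7 : δ ≤ c0 * e ^ 2 := by
      rw [hδe]
      exact mul_le_mul_of_nonneg_left (pow_le_pow_of_le_one he0.le he1.le (by norm_num)) hc00.le
    have h8 : K * δ + L * ρ ≤ (K2 * c0 * e) * e := by
      have : K * δ ≤ K * (c0 * e ^ 2) := mul_le_mul_of_nonneg_left h7 hK.le
      rw [hK2, hρdef]; linarith
    exact le_of_mul_le_mul_right (h6.trans h8) he0
  refine ⟨π', fun t => ?_⟩
  rw [hπp, abs_sub_comm (w' _), abs_sub_comm (μ' _)]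
  refine ⟨?_, hp t⟩
  have hw : w t - w' (p t) = (AA w μ t - AA w' μ' (p t)) * Real.exp ((μ t) ^ 2 / 2) +
      AA w' μ' (p t) * (Real.exp ((μ t) ^ 2 / 2) - Real.exp ((μ' (p t)) ^ 2 / 2)) := by
    conv_lhs => rw [w_eq_AA w μ t, w_eq_AA w' μ' (p t)]
    ring
  rw [hw]
  have h1 : |(AA w μ t - AA w' μ' (p t)) * Real.exp ((μ t) ^ 2 / 2)| ≤ K2 * c0 * e * E := by
    rw [abs_mul, Real.abs_exp]
    exact mul_le_mul (hAA t) (exp_sq_le (hG.bd t)) (Real.exp_pos _).le (by positivity)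
  have h2 : |AA w' μ' (p t) * (Real.exp ((μ t) ^ 2 / 2) - Real.exp ((μ' (p t)) ^ 2 / 2))| ≤
      1 * (E * M * ρ) := by
    rw [abs_mul, abs_of_pos (AA_pos hG' _)]
    refine mul_le_mul ((AA_le hG' _).trans (hG'.w_le _)) ?_ (abs_nonneg _) zero_le_one
    refine (exp_sq_lip (hG.bd t) (hG'.bd (p t))).trans ?_
    exact mul_le_mul_of_nonneg_left (hρ t) (by positivity)
  refine (abs_add_le _ _).trans_lt ?_
  have h3 : 1 * (E * M * ρ) ≤ c0 * (E * M * K1) * e := by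
    have : e ^ 2 ≤ e := pow_le_of_le_one he0.le he1.le (by norm_num)
    have : 1 * (E * M * ρ) = c0 * (E * M * K1) * e ^ 2 := by rw [hρdef]; ring
    rw [this]; gcongr
  have h4 : K2 * c0 * e * E = c0 * (E * K2) * e := by ring
  have h5 : c0 * (E * K2) * e + c0 * (E * M * K1) * e < e := by
    have : c0 * (E * K2) + c0 * (E * M * K1) < 1 := by linarith
    rw [← add_mul]
    exact mul_lt_of_lt_one_left he0 this
  linarith

lemma meas_some : Measurable (Option.some : ℝ → Option ℝ) := by
  intro s hs
  have h : MeasurableSet ((Equiv.optionEquivSumPUnit.{0} ℝ).symm ⁻¹' s) := hs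
  have := measurable_inl h
  exact this

lemma meas_some_image {I : Set ℝ} (hI : MeasurableSet I) : MeasurableSet (Option.some '' I) := by
  change MeasurableSet ((Equiv.optionEquivSumPUnit.{0} ℝ).symm ⁻¹' (Option.some '' I))
  have : (Equiv.optionEquivSumPUnit.{0} ℝ).symm ⁻¹' (Option.some '' I) = Sum.inl '' I := by
    ext x
    rcases x with x | x <;> simp
  rw [this]
  exact MeasurableSet.inl_image hI

lemma gaussd_pdf (μ x : ℝ) : gaussd μ x = ProbabilityTheory.gaussianPDFReal μ 1 x := by
  simp [gaussd, ProbabilityTheory.gaussianPDFReal]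

lemma gaussd_nonneg (μ x : ℝ) : 0 ≤ gaussd μ x := by unfold gaussd; positivity

lemma gaussd_integrable (μ : ℝ) : Integrable (gaussd μ) := by
  have : gaussd μ = ProbabilityTheory.gaussianPDFReal μ 1 := funext (gaussd_pdf μ)
  rw [this]; exact ProbabilityTheory.integrable_gaussianPDFReal μ 1

lemma gaussd_integral (μ : ℝ) : ∫ x, gaussd μ x = 1 := by
  have : gaussd μ = ProbabilityTheory.gaussianPDFReal μ 1 := funext (gaussd_pdf μ)
  rw [this]; exact ProbabilityTheory.integral_gaussianPDFReal_eq_one μ one_ne_zero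

lemma mix_nonneg {k : ℕ} {w : Fin k → ℝ} (hw : ∀ t, 0 < w t) (μ : Fin k → ℝ) (x : ℝ) :
    0 ≤ ∑ t, w t * gaussd (μ t) x :=
  Finset.sum_nonneg fun t _ => mul_nonneg (hw t).le (gaussd_nonneg _ _)

lemma mix_le_one (R : ℝ) {k : ℕ} {w : Fin k → ℝ} (hw : ∀ t, 0 < w t) (hs : ∑ t, w t = 1) (μ : Fin k → ℝ) :
    ∫ x in Set.Icc (-R) R, ∑ t, w t * gaussd (μ t) x ≤ 1 := by
  have hi : Integrable (fun x => ∑ t, w t * gaussd (μ t) x) :=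
    integrable_finsetSum _ fun t _ => (gaussd_integrable _).const_mul _
  calc _ ≤ ∫ x, ∑ t, w t * gaussd (μ t) x :=
        setIntegral_le_integral hi (Filter.Eventually.of_forall fun x => mix_nonneg hw μ x)
    _ = 1 := by
      rw [integral_finsetSum _ fun t _ => (gaussd_integrable _).const_mul _]
      simp only [integral_const_mul, gaussd_integral, mul_one, hs]

lemma dens_apply (R : ℝ) {k : ℕ} {w : Fin k → ℝ} (hw : ∀ t, 0 < w t) (μ : Fin k → ℝ) {I : Set ℝ}
    (hI : MeasurableSet I) :
    (volume.withDensity fun x =>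
        ENNReal.ofReal ((Set.Icc (-R) R).indicator (fun y => ∑ t, w t * gaussd (μ t) y) x)) I =
      ENNReal.ofReal (∫ x in I ∩ Set.Icc (-R) R, ∑ t, w t * gaussd (μ t) x) := by
  have hi : Integrable (fun x => ∑ t, w t * gaussd (μ t) x) :=
    integrable_finsetSum _ fun t _ => (gaussd_integrable _).const_mul _
  rw [withDensity_apply _ hI, ← setIntegral_indicator measurableSet_Icc,
    ofReal_integral_eq_lintegral_ofReal]
  · exact (hi.indicator measurableSet_Icc).integrableOn
  · exact Filter.Eventually.of_forall fun x => Set.indicator_nonneg (fun x _ => mix_nonneg hw μ x) x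

lemma censored_prob (R : ℝ) {k : ℕ} {w : Fin k → ℝ} (hw : ∀ t, 0 < w t) (hs : ∑ t, w t = 1)
    (μ : Fin k → ℝ) : IsProbabilityMeasure (censored R k w μ) := by
  constructor
  unfold censored
  rw [Measure.add_apply, Measure.map_apply meas_some MeasurableSet.univ, Set.preimage_univ,
    dens_apply R hw μ MeasurableSet.univ, Set.univ_inter, Measure.smul_apply, measure_univ, smul_eq_mul,
    mul_one]
  apply add_tsub_cancel_of_le
  rw [← ENNReal.ofReal_one]
  exact ENNReal.ofReal_le_ofReal (mix_le_one R hw hs μ)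

lemma censored_int {R : ℝ} (hR : 0 < R) {k N j : ℕ} (hj : j < N) {w : Fin k → ℝ} (hw : ∀ t, 0 < w t)
    (μ : Fin k → ℝ) :
    (censored R k w μ).real (Option.some '' Set.Icc (lft R N j) (rgt R N j)) = PP R N k w μ j := by
  have hm := meas_some_image (measurableSet_Icc (a := lft R N j) (b := rgt R N j))
  unfold Measure.real censored
  rw [Measure.add_apply, Measure.map_apply meas_some hm,
    Set.preimage_image_eq _ (Option.some_injective ℝ), dens_apply R hw μ measurableSet_Icc,
    Measure.smul_apply, Measure.dirac_apply' _ hm]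
  have : Set.Icc (lft R N j) (rgt R N j) ∩ Set.Icc (-R) R = Set.Icc (lft R N j) (rgt R N j) :=
    Set.inter_eq_left.mpr (Set.Icc_subset_Icc (lft_ge hR hj) (rgt_le hR hj))
  rw [this]
  have h0 : 0 ≤ ∫ x in Set.Icc (lft R N j) (rgt R N j), ∑ t, w t * gaussd (μ t) x :=
    integral_nonneg fun x => mix_nonneg hw μ x
  simp [PP, ENNReal.toReal_ofReal h0]

noncomputable def cnt {Ω : Type} {n : ℕ} (S : Set Ω) (xs : Fin n → Ω) : ℕ :=
  ∑ i, S.indicator (fun _ => 1) (xs i)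

lemma cnt_meas {Ω : Type} [MeasurableSpace Ω] {n : ℕ} {S : Set Ω} (hS : MeasurableSet S) :
    Measurable (cnt (n := n) S) := by
  unfold cnt
  exact Finset.measurable_sum _ fun i _ => (measurable_const.indicator hS).comp (measurable_pi_apply i)

lemma cheb {Ω : Type} [MeasurableSpace Ω] (P : Measure Ω) [IsProbabilityMeasure P] {S : Set Ω}
    (hS : MeasurableSet S) {n : ℕ} (hn : 0 < n) {η : ℝ} (hη : 0 < η) :
    Measure.pi (fun _ : Fin n => P) {xs | η ≤ |P.real S - (cnt S xs : ℝ) / n|} ≤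
      ENNReal.ofReal (1 / (n * η ^ 2)) := by
  have hn' : (0:ℝ) < n := by exact_mod_cast hn
  set X : Fin n → Ω → ℝ := fun _ => S.indicator (fun _ => 1) with hX
  have hXm : ∀ i, Measurable (X i) := fun i => measurable_const.indicator hS
  have hL : ∀ i, MemLp (X i) 2 P := fun i => memLp_indicator_const 2 hS 1 (Or.inr (measure_ne_top _ _))
  have hXL : ∀ i, MemLp (fun ω : Fin n → Ω => X i (ω i)) 2 (Measure.pi fun _ => P) := fun i =>
    (hL i).comp_measurePreserving (measurePreserving_eval _ i)
  have hsum : MemLp (∑ i, fun ω : Fin n → Ω => X i (ω i)) 2 (Measure.pi fun _ => P) :=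
    memLp_finsetSum' _ fun i _ => hXL i
  have hc := ProbabilityTheory.meas_ge_le_variance_div_sq hsum (c := n * η) (by positivity)
  rw [ProbabilityTheory.variance_sum_pi hL] at hc
  have hv : ∑ i, ProbabilityTheory.variance (X i) P ≤ n := by
    calc _ ≤ ∑ i : Fin n, (1:ℝ) := by
          apply Finset.sum_le_sum
          intro i _
          refine (ProbabilityTheory.variance_le_sq_of_bounded (a := 0) (b := 1) ?_
            (hXm i).aemeasurable).trans (by norm_num)
          refine Filter.Eventually.of_forall fun ω => ?_
          by_cases h : ω ∈ S <;> simp [hX, h]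
      _ = n := by simp
  have hmean : ∫ ω, (∑ i, fun ω : Fin n → Ω => X i (ω i)) ω ∂(Measure.pi fun _ => P) = n * P.real S := by
    simp only [Finset.sum_apply]
    rw [integral_finsetSum _ fun i _ => (hXL i).integrable (by norm_num)]
    have : ∀ i : Fin n, ∫ ω : Fin n → Ω, X i (ω i) ∂(Measure.pi fun _ => P) = P.real S := by
      intro i
      rw [integral_comp_eval (μ := fun _ : Fin n => P) (f := X i) (hXm i).aestronglyMeasurable]
      simp only [hX]
      rw [integral_indicator_const _ hS]; simp
    simp [this]
  rw [hmean] at hc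
  refine (measure_mono ?_).trans (hc.trans (ENNReal.ofReal_le_ofReal ?_))
  · intro xs hxs
    simp only [Set.mem_ofPred_eq] at hxs ⊢
    have h1 : (∑ i, fun ω : Fin n → Ω => X i (ω i)) xs = (cnt S xs : ℝ) := by
      simp only [Finset.sum_apply, cnt, hX]
      push_cast
      apply Finset.sum_congr rfl
      intro i _
      by_cases h : xs i ∈ S <;> simp [h]
    rw [h1]
    have h2 : (cnt S xs : ℝ) - n * P.real S = -(n * (P.real S - (cnt S xs : ℝ) / n)) := by
      field_simp; ring
    rw [h2, abs_neg, abs_mul, abs_of_pos hn']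
    exact mul_le_mul_of_nonneg_left hxs hn'.le
  · rw [div_le_div_iff₀ (by positivity) (by positivity)]
    have : 0 ≤ (n:ℝ) * η ^ 2 := by positivity
    nlinarith [mul_le_mul_of_nonneg_right hv this]

lemma good_of_hyp {k : ℕ} {M C ε : ℝ} (hM : 0 < M) (hε : 0 < ε) (hC : 2 * M + 4 ≤ C) {w μ : Fin k → ℝ}
    (hw : ∀ t, 0 < w t) (hs : ∑ t, w t = 1) (hμ : ∀ t, μ t ∈ Set.Ioo (-M) M)
    (h : C * ε ≤ (⨅ t, w t) * ⨅ p : {p : Fin k × Fin k // p.1 ≠ p.2}, |μ p.1.1 - μ p.1.2|) :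
    Good k M ε w μ := by
  have hbd : ∀ t, |μ t| ≤ M := fun t => abs_le.mpr ⟨(hμ t).1.le, (hμ t).2.le⟩
  set D := ⨅ p : {p : Fin k × Fin k // p.1 ≠ p.2}, |μ p.1.1 - μ p.1.2| with hD
  have hwle : ∀ t, (⨅ t, w t) ≤ w t := fun t => ciInf_le (Set.finite_range _).bddBelow t
  have hDle : ∀ p : {p : Fin k × Fin k // p.1 ≠ p.2}, D ≤ |μ p.1.1 - μ p.1.2| :=
    fun p => ciInf_le (Set.finite_range _).bddBelow p
  have hD0 : 0 ≤ D := Real.iInf_nonneg fun _ => abs_nonneg _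
  have hw1 : ∀ t, w t ≤ 1 := fun t => by
    rw [← hs]; exact Finset.single_le_sum (fun i _ => (hw i).le) (Finset.mem_univ t)
  have hCε : 0 < C * ε := by apply mul_pos _ hε; linarith
  have hDM : D ≤ 2 * M := by
    rcases isEmpty_or_nonempty {p : Fin k × Fin k // p.1 ≠ p.2} with he | ⟨⟨p⟩⟩
    · rw [hD, Real.iInf_of_isEmpty]; linarith
    · refine (hDle p).trans ((abs_sub _ _).trans ?_)
      linarith [hbd p.1.1, hbd p.1.2]
  have h1 : ∀ t, C * ε ≤ w t * D := fun t => h.trans (mul_le_mul_of_nonneg_right (hwle t) hD0)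
  refine ⟨hw, hs, hbd, fun t => ?_, fun s t hst => ?_⟩
  · have h2 : w t * D ≤ w t * (2 * M) := mul_le_mul_of_nonneg_left hDM (hw t).le
    have h3 := h1 t
    have h4 : ε * (2 * M) ≤ C * ε := by nlinarith
    exact le_of_mul_le_mul_right (h4.trans (h3.trans h2)) (by linarith)
  · have h2 := h1 t
    have h3 : w t * D ≤ D := mul_le_of_le_one_left hD0 (hw1 t)
    have h4 := hDle ⟨(s, t), hst⟩
    simp only at h4
    nlinarith

/-- Main theorem: learning mixtures of `k` univariate homogeneous Gaussians from censored data.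
There is an absolute constant `c > 0` such that for every `k ≥ 1` and `M, R > 0` there is a
constant `C_k > 0` so that for every sufficiently small `ε > 0`, with `n = ⌈C_k ε^{-ck}⌉`
censored samples there is a measurable estimator recovering all weights and means to within
`ε`, up to permutation, with probability at least `99/100`, whenever
`w_min · Δ_min ≥ C_k · ε`. -/
theorem learn_censored_gaussian_mixture :
    ∃ c : ℝ, 0 < c ∧
      ∀ k : ℕ, 1 ≤ k → ∀ M R : ℝ, 0 < M → 0 < R →
        ∃ Ck : ℝ, 0 < Ck ∧ ∃ ε₀ : ℝ, 0 < ε₀ ∧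
          ∀ ε : ℝ, 0 < ε → ε < ε₀ →
            ∀ n : ℕ, n = ⌈Ck * ε ^ (-(c * (k : ℝ)))⌉₊ →
              ∃ T : (Fin n → Option ℝ) → (Fin k → ℝ) × (Fin k → ℝ), Measurable T ∧
                ∀ w μ : Fin k → ℝ, (∀ t, 0 < w t) → ∑ t, w t = 1 →
                  (∀ t, μ t ∈ Set.Ioo (-M) M) →
                  Ck * ε ≤
                      (⨅ t, w t) *
                        ⨅ p : {p : Fin k × Fin k // p.1 ≠ p.2}, |μ p.1.1 - μ p.1.2| →
                  (99 / 100 : ENNReal) ≤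
                    Measure.pi (fun _ : Fin n => censored R k w μ)
                      {xs | ∃ perm : Equiv.Perm (Fin k),
                        ∀ t, |(T xs).1 (perm t) - w t| < ε ∧ |(T xs).2 (perm t) - μ t| < ε} := by
  refine ⟨8, by norm_num, ?_⟩
  intro k hk M R hM hR
  obtain ⟨c0, hc0, hid⟩ := ident k hk M R hM hR
  set N : ℕ := 2 ^ (2 * k) with hN
  have hNpos : (0:ℝ) < N := by positivity
  refine ⟨2 * M + 4 + 400 * N / c0 ^ 2, by positivity, 1, one_pos, ?_⟩
  set C := 2 * M + 4 + 400 * N / c0 ^ 2 with hC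
  have hC1 : 2 * M + 4 ≤ C := by
    have : 0 ≤ 400 * (N:ℝ) / c0 ^ 2 := by positivity
    linarith
  have hC2 : 400 * (N:ℝ) / c0 ^ 2 ≤ C := by linarith
  have hCpos : 0 < C := by linarith
  intro ε hε hε1 n hn
  set η := c0 * ε ^ (4 * k) / 2 with hη
  have hη0 : 0 < η := by positivity
  have hpow : ε ^ (-(8 * (k:ℝ))) = (ε ^ (8 * k))⁻¹ := by
    rw [Real.rpow_neg hε.le]
    congr 1
    rw [← Real.rpow_natCast]; push_cast; rfl
  have hnle : C * (ε ^ (8 * k))⁻¹ ≤ n := by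
    rw [hn, ← hpow]; exact Nat.le_ceil _
  have hnpos' : (0:ℝ) < n := lt_of_lt_of_le (by positivity) hnle
  have hnpos : 0 < n := by exact_mod_cast hnpos'
  have hnη : 100 * (N:ℝ) ≤ n * η ^ 2 := by
    have h1 : 400 * (N:ℝ) / c0 ^ 2 * (ε ^ (8 * k))⁻¹ ≤ n :=
      (mul_le_mul_of_nonneg_right hC2 (by positivity)).trans hnle
    have h2 : 400 * (N:ℝ) / c0 ^ 2 * (ε ^ (8 * k))⁻¹ * η ^ 2 = 100 * N := by
      have h3 : η ^ 2 = c0 ^ 2 * ε ^ (8 * k) / 4 := by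
        rw [hη, div_pow, mul_pow, ← pow_mul]
        have : 4 * k * 2 = 8 * k := by ring
        rw [this]; norm_num
      rw [h3]; field_simp; norm_num
    rw [← h2]
    exact mul_le_mul_of_nonneg_right h1 (by positivity)
  classical
  let S : Fin N → Set (Option ℝ) := fun j => Option.some '' Set.Icc (lft R N j) (rgt R N j)
  have hS : ∀ j, MeasurableSet (S j) := fun j => meas_some_image measurableSet_Icc
  let Q : (Fin N → ℕ) → ((Fin k → ℝ) × (Fin k → ℝ)) → Prop := fun v q =>
    Good k M ε q.1 q.2 ∧ ∀ j : Fin N, |PP R N k q.1 q.2 j - (v j : ℝ) / n| < η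
  let F : (Fin N → ℕ) → (Fin k → ℝ) × (Fin k → ℝ) := fun v =>
    if h : ∃ q, Q v q then h.choose else 0
  have hF : ∀ v q, Q v q → Q v (F v) := by
    intro v q hq
    have h : ∃ q, Q v q := ⟨q, hq⟩
    simp only [F, dif_pos h]
    exact h.choose_spec
  let V : (Fin n → Option ℝ) → (Fin N → ℕ) := fun xs j => cnt (S j) xs
  have hV : Measurable V := measurable_pi_iff.mpr fun j => cnt_meas (hS j)
  refine ⟨F ∘ V, (measurable_of_countable F).comp hV, ?_⟩
  intro w μ hw hs hμ hsep
  have hG : Good k M ε w μ := good_of_hyp hM hε hC1 hw hs hμ hsep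
  haveI := censored_prob R hw hs μ
  set P := censored R k w μ with hP
  have hbad : ∀ j : Fin N, Measure.pi (fun _ : Fin n => P) {xs | η ≤ |PP R N k w μ j - (V xs j : ℝ) / n|} ≤
      ENNReal.ofReal (1 / (n * η ^ 2)) := by
    intro j
    have := cheb P (hS j) hnpos hη0
    rw [hP, censored_int hR j.2 hw μ] at this
    exact this
  set Bd : Set (Fin n → Option ℝ) := ⋃ j : Fin N, {xs | η ≤ |PP R N k w μ j - (V xs j : ℝ) / n|} with hBd
  have hBdm : MeasurableSet Bd := by
    refine MeasurableSet.iUnion fun j => ?_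
    have hVj : Measurable fun xs => (V xs j : ℝ) :=
      (measurable_of_countable (fun m : ℕ => (m : ℝ))).comp (cnt_meas (hS j))
    have : Measurable fun xs => |PP R N k w μ j - (V xs j : ℝ) / n| := by
      have h1 : Measurable fun xs => PP R N k w μ j - (V xs j : ℝ) / n :=
        measurable_const.sub (hVj.div_const _)
      exact continuous_abs.measurable.comp h1
    exact measurableSet_le measurable_const this
  have hBdle : Measure.pi (fun _ : Fin n => P) Bd ≤ 1 / 100 := by
    refine (measure_iUnion_le _).trans ?_
    rw [tsum_fintype]
    refine (Finset.sum_le_sum fun j _ => hbad j).trans ?_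
    rw [Finset.sum_const, Finset.card_univ, Fintype.card_fin, nsmul_eq_mul, ← ENNReal.ofReal_natCast,
      ← ENNReal.ofReal_mul (by positivity)]
    have : (1 / 100 : ENNReal) = ENNReal.ofReal (1 / 100) := by
      rw [ENNReal.ofReal_div_of_pos (by norm_num)]; norm_num
    rw [this]
    apply ENNReal.ofReal_le_ofReal
    rw [mul_one_div, div_le_div_iff₀ (by positivity) (by norm_num)]
    linarith
  have hgood : (99 / 100 : ENNReal) ≤ Measure.pi (fun _ : Fin n => P) Bdᶜ := by
    rw [prob_compl_eq_one_sub hBdm]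
    have h1 : (99 / 100 : ENNReal) = 1 - 1 / 100 := by
      refine ENNReal.eq_sub_of_add_eq (by simp) ?_
      rw [← ENNReal.add_div]; norm_num
      exact ENNReal.div_self (by norm_num) (by norm_num)
    rw [h1]
    exact tsub_le_tsub_left hBdle 1
  refine hgood.trans (measure_mono ?_)
  intro xs hxs
  have hx : ∀ j : Fin N, |PP R N k w μ j - (V xs j : ℝ) / n| < η := by
    intro j
    by_contra! hcon
    exact hxs (Set.mem_iUnion.mpr ⟨j, hcon⟩)
  have hq : Q (V xs) (F (V xs)) := hF (V xs) (w, μ) ⟨hG, hx⟩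
  refine hid ε w μ (F (V xs)).1 (F (V xs)).2 hε hε1 hG hq.1 ?_
  intro j hj
  have h1 := hx ⟨j, hj⟩
  have h2 := hq.2 ⟨j, hj⟩
  simp only at h1 h2
  have h3 := abs_sub_le (PP R N k w μ j) ((V xs ⟨j, hj⟩ : ℝ) / n) (PP R N k (F (V xs)).1 (F (V xs)).2 j)
  rw [abs_sub_comm ((V xs ⟨j, hj⟩ : ℝ) / n)] at h3
  have h4 : η + η = c0 * ε ^ (4 * k) := by rw [hη]; ring
  linarith
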